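/- arXiv:2205.01301 — 6 statements merged into one kernel-verified Lean document; each statement's English description precedes it below -/
import Mathlib

section
/- The increasing profile is unique: if θ : ℝ → ℝ is twice continuously differentiable, monotone nondecreasing, satisfies θ''(ρ) = f'(θ(ρ)) = (θ(ρ)³ - θ(ρ))/2 for all ρ ∈ ℝ, θ(0) = 0, θ(ρ) → 1 as ρ → +∞ and θ(ρ) → -1 as ρ → -∞, then θ(ρ) = tanh(ρ/2) for all ρ ∈ ℝ. -/
open Filter

/-- uniqueness of the increasing profile.  If `θ` is `C²`, monotone
nondecreasing, solves `θ'' = f'(θ) = (θ³ - θ)/2`, vanishes at `0` and tends to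
`±1` at `±∞`, then `θ(ρ) = tanh(ρ/2)`. -/
theorem stmt2 (θ : ℝ → ℝ)
    (hC2 : ContDiff ℝ 2 θ)
    (hmono : Monotone θ)
    (hode : ∀ ρ : ℝ, deriv (deriv θ) ρ = ((θ ρ) ^ 3 - θ ρ) / 2)
    (h0 : θ 0 = 0)
    (htop : Tendsto θ atTop (nhds 1))
    (hbot : Tendsto θ atBot (nhds (-1))) :
    ∀ ρ : ℝ, θ ρ = Real.tanh (ρ / 2) := by
  have hd : ∀ x, HasDerivAt θ (deriv θ x) x := fun x =>
    (hC2.differentiable (by norm_num) x).hasDerivAt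
  have hC1 : ContDiff ℝ 1 (deriv θ) := by
    have h : ContDiff ℝ (1 + 1) θ := by
      convert hC2 using 1
      norm_num
    exact (contDiff_succ_iff_deriv.1 h).2.2
  have hdd : ∀ x, HasDerivAt (deriv θ) (((θ x) ^ 3 - θ x) / 2) x := fun x => by
    rw [← hode x]
    exact (hC1.differentiable (by norm_num) x).hasDerivAt
  have hE : ∀ x, HasDerivAt (fun y => (deriv θ y) ^ 2 - (1 - (θ y) ^ 2) ^ 2 / 4) 0 x := fun x => by
    have h := ((hdd x).fun_pow 2).sub (((((hd x).fun_pow 2).const_sub 1).fun_pow 2).div_const 4)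
    refine h.congr_deriv ?_
    norm_num
    ring
  have hconst : ∀ x y, (deriv θ x) ^ 2 - (1 - (θ x) ^ 2) ^ 2 / 4
      = (deriv θ y) ^ 2 - (1 - (θ y) ^ 2) ^ 2 / 4 :=
    is_const_of_deriv_eq_zero (fun x => (hE x).differentiableAt) (fun x => (hE x).deriv)
  have hmv : ∀ n : ℕ, ∃ ξ : ℝ, (n : ℝ) < ξ ∧ deriv θ ξ = θ (n + 1) - θ n := fun n => by
    obtain ⟨ξ, hξ, h⟩ := exists_hasDerivAt_eq_slope θ (deriv θ) (show (n : ℝ) < n + 1 by linarith)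
      (hC2.continuous.continuousOn) (fun x _ => hd x)
    refine ⟨ξ, hξ.1, ?_⟩
    rw [h]
    simp
  choose ξ hξ hξ' using hmv
  have hξt : Tendsto ξ atTop atTop :=
    tendsto_atTop_mono (fun n => (hξ n).le) tendsto_natCast_atTop_atTop
  have h1 : Tendsto (fun n => deriv θ (ξ n)) atTop (nhds 0) := by
    simp_rw [hξ']
    have a := htop.comp (tendsto_natCast_atTop_atTop (R := ℝ))
    have b := htop.comp (tendsto_atTop_add_const_right _ (1 : ℝ)
      (tendsto_natCast_atTop_atTop (R := ℝ)))
    simpa using b.sub a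
  have h2 : Tendsto (fun n => (deriv θ (ξ n)) ^ 2 - (1 - (θ (ξ n)) ^ 2) ^ 2 / 4) atTop
      (nhds (0 ^ 2 - (1 - 1 ^ 2) ^ 2 / 4)) :=
    (h1.pow 2).sub (((((htop.comp hξt).pow 2).const_sub 1).pow 2).div_const 4)
  have hzero : ∀ x, (deriv θ x) ^ 2 - (1 - (θ x) ^ 2) ^ 2 / 4 = 0 := fun x => by
    simp_rw [fun n => hconst (ξ n) x] at h2
    have := tendsto_nhds_unique h2 tendsto_const_nhds
    norm_num at this
    linarith
  have hle : ∀ x, θ x ≤ 1 := fun x => hmono.ge_of_tendsto htop x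
  have hge : ∀ x, -1 ≤ θ x := fun x => hmono.le_of_tendsto hbot x
  have hfirst : ∀ x, deriv θ x = (1 - (θ x) ^ 2) / 2 := fun x => by
    have hn : 0 ≤ deriv θ x := hmono.deriv_nonneg
    have hp : 0 ≤ (1 - (θ x) ^ 2) / 2 := by nlinarith [hle x, hge x]
    refine (sq_eq_sq₀ hn hp).1 ?_
    linarith [hzero x]
  have hI : ∀ x, HasDerivAt (fun y => ∫ t in (0 : ℝ)..y, θ t / 2) (θ x / 2) x := fun x =>
    (hC2.continuous.div_const 2).integral_hasStrictDerivAt 0 x |>.hasDerivAt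
  have hP : ∀ x, HasDerivAt (fun y => (θ y * Real.cosh (y / 2) - Real.sinh (y / 2)) *
      Real.exp (∫ t in (0 : ℝ)..y, θ t / 2)) 0 x := fun x => by
    have hh : HasDerivAt (fun y : ℝ => y / 2) (1 / 2) x := (hasDerivAt_id x).div_const 2
    have h := (((hd x).fun_mul hh.cosh).fun_sub hh.sinh).fun_mul (hI x).exp
    refine h.congr_deriv ?_
    rw [hfirst x]
    ring
  have hPc := is_const_of_deriv_eq_zero (fun x => (hP x).differentiableAt) (fun x => (hP x).deriv)
  intro ρ
  have h := hPc ρ 0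
  simp [h0] at h
  rw [Real.tanh_eq_sinh_div_cosh, eq_div_iff (Real.cosh_pos _).ne']
  linarith
end

section
/- The one-dimensional linearized Allen–Cahn operator around the optimal profile is nonnegative: for every continuously differentiable function φ : ℝ → ℝ with compact support, ∫_ℝ ( φ'(ρ)² + ((3 tanh²(ρ/2) - 1)/2) φ(ρ)² ) dρ ≥ 0. -/
open MeasureTheory

lemma tanh_half_hasDerivAt (x : ℝ) :
    HasDerivAt (fun ρ : ℝ => Real.tanh (ρ / 2)) ((1 - Real.tanh (x / 2) ^ 2) / 2) x := by
  have h2 : HasDerivAt (fun ρ : ℝ => ρ / 2) (1 / 2) x := (hasDerivAt_id x).div_const 2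
  have hc : Real.cosh (x / 2) ≠ 0 := (Real.cosh_pos _).ne'
  have h := h2.sinh.div h2.cosh hc
  have e : (fun ρ : ℝ => Real.tanh (ρ / 2)) =
      (fun ρ : ℝ => Real.sinh (ρ / 2)) / (fun ρ : ℝ => Real.cosh (ρ / 2)) := by
    funext ρ
    simp [Real.tanh_eq_sinh_div_cosh]
  rw [e]
  refine h.congr_deriv ?_
  rw [Real.tanh_eq_sinh_div_cosh]
  field_simp

/-- the one-dimensional linearized Allen–Cahn operator around the
optimal profile is nonnegative: for every `C¹` compactly supported `φ`,
`∫_ℝ ( φ'(ρ)² + ((3 tanh²(ρ/2) - 1)/2) φ(ρ)² ) dρ ≥ 0`. -/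
theorem stmt8 (φ : ℝ → ℝ) (hφ : ContDiff ℝ 1 φ) (hsupp : HasCompactSupport φ) :
    0 ≤ ∫ ρ : ℝ,
      ((deriv φ ρ) ^ 2 + ((3 * (Real.tanh (ρ / 2)) ^ 2 - 1) / 2) * (φ ρ) ^ 2) := by
  have ht : Continuous (fun ρ : ℝ => Real.tanh (ρ / 2)) :=
    continuous_iff_continuousAt.2 fun x => (tanh_half_hasDerivAt x).continuousAt
  have hc : Continuous φ := hφ.continuous
  have hd : Continuous (deriv φ) := hφ.continuous_deriv le_rfl
  have hD : ∀ x, HasDerivAt φ (deriv φ x) x := fun x =>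
    (hφ.differentiable one_ne_zero x).hasDerivAt
  have hz : ∀ x, x ∉ tsupport φ → φ x = 0 ∧ deriv φ x = 0 := fun x hx =>
    ⟨image_eq_zero_of_notMem_tsupport hx,
      Function.notMem_support.1 fun h => hx (support_deriv_subset h)⟩
  have key : ∀ g : ℝ → ℝ, Continuous g → (∀ x, φ x = 0 → deriv φ x = 0 → g x = 0) →
      Integrable g := fun g hg h0 =>
    hg.integrable_of_hasCompactSupport
      (HasCompactSupport.intro hsupp fun x hx => h0 x (hz x hx).1 (hz x hx).2)
  let G : ℝ → ℝ := fun x => Real.tanh (x / 2) * φ x ^ 2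
  let G' : ℝ → ℝ := fun x => (1 - Real.tanh (x / 2) ^ 2) / 2 * φ x ^ 2
    + Real.tanh (x / 2) * (2 * φ x * deriv φ x)
  have hG : ∀ x, HasDerivAt G (G' x) x := fun x => by
    have := (tanh_half_hasDerivAt x).mul ((hD x).pow 2)
    refine this.congr_deriv ?_
    simp [G']
  have iG : Integrable G := key G (by fun_prop) (by intro x h _; simp [G, h])
  have iG' : Integrable G' := key G' (by fun_prop) (by intro x h h'; simp [G', h])
  have h0 : ∫ x, G' x = 0 := integral_eq_zero_of_hasDerivAt_of_integrable hG iG' iG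
  have iS : Integrable (fun x => (deriv φ x + Real.tanh (x / 2) * φ x) ^ 2) :=
    key _ (by fun_prop) (by intro x h h'; simp [h, h'])
  have e : ∀ ρ : ℝ, (deriv φ ρ) ^ 2 + ((3 * (Real.tanh (ρ / 2)) ^ 2 - 1) / 2) * (φ ρ) ^ 2
      = (deriv φ ρ + Real.tanh (ρ / 2) * φ ρ) ^ 2 - G' ρ := by
    intro ρ
    simp only [G']
    ring
  simp_rw [e]
  rw [integral_sub iS iG', h0, sub_zero]
  exact integral_nonneg fun x => sq_nonneg _
end

section
/- One-dimensional interpolation (Agmon) inequality: there is a constant C > 0 such that for every continuously differentiable function u : ℝ → ℝ with compact support, sup_{x ∈ ℝ} |u(x)| ≤ C ( ∫_ℝ u(x)² dx )^{1/4} ( ∫_ℝ u(x)² dx + ∫_ℝ u'(x)² dx )^{1/4}; that is, ‖u‖_{L^∞(ℝ)} ≤ C ‖u‖_{L²(ℝ)}^{1/2} ‖u‖_{H¹(ℝ)}^{1/2}. -/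
open MeasureTheory

/-- one-dimensional interpolation (Agmon) inequality:
`‖u‖_{L^∞(ℝ)} ≤ C ‖u‖_{L²(ℝ)}^{1/2} ‖u‖_{H¹(ℝ)}^{1/2}` for `C¹` compactly
supported `u : ℝ → ℝ`. -/
theorem stmt14 :
    ∃ C : ℝ, 0 < C ∧
      ∀ u : ℝ → ℝ, ContDiff ℝ 1 u → HasCompactSupport u →
        ∀ x : ℝ, |u x| ≤
          C * (∫ y : ℝ, (u y) ^ 2) ^ ((1 : ℝ) / 4) *
            ((∫ y : ℝ, (u y) ^ 2) + ∫ y : ℝ, (deriv u y) ^ 2) ^ ((1 : ℝ) / 4) := by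
  refine ⟨2, by norm_num, fun u hu hs x => ?_⟩
  have hc : Continuous u := hu.continuous
  have hd : Continuous (deriv u) := hu.continuous_deriv le_rfl
  have hds : HasCompactSupport (deriv u) := hs.deriv
  have h1 : ∫ y in Set.Iic x, deriv (fun z => u z ^ 2) y = u x ^ 2 := by
    have hsq : HasCompactSupport (fun z => u z ^ 2) := by
      have := hs.mul_right (f' := u)
      simp only [pow_two]
      exact this
    exact HasCompactSupport.integral_Iic_deriv_eq (hu.pow 2) hsq x
  have hder : ∀ y, deriv (fun z => u z ^ 2) y = 2 * (u y * deriv u y) := by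
    intro y
    have := ((hu.differentiable one_ne_zero) y).hasDerivAt.pow 2
    refine (HasDerivAt.deriv (f := fun z => u z ^ 2) this).trans ?_
    simp
    ring
  have hint : Integrable (fun y => 2 * (‖u y‖ * ‖deriv u y‖)) := by
    have h : Integrable (fun y => u y * deriv u y) :=
      (hc.mul hd).integrable_of_hasCompactSupport hs.mul_right
    simpa [norm_mul] using h.norm.const_mul 2
  have h2 : u x ^ 2 ≤ ∫ y, 2 * (‖u y‖ * ‖deriv u y‖) := by
    rw [← h1]
    calc ∫ y in Set.Iic x, deriv (fun z => u z ^ 2) y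
        ≤ ‖∫ y in Set.Iic x, deriv (fun z => u z ^ 2) y‖ := Real.le_norm_self _
      _ ≤ ∫ y in Set.Iic x, ‖deriv (fun z => u z ^ 2) y‖ := norm_integral_le_integral_norm _
      _ = ∫ y in Set.Iic x, 2 * (‖u y‖ * ‖deriv u y‖) := by
          simp only [hder, norm_mul, Real.norm_ofNat]
      _ ≤ ∫ y, 2 * (‖u y‖ * ‖deriv u y‖) :=
          setIntegral_le_integral hint (Filter.Eventually.of_forall fun y => by positivity)
  have h3 := integral_mul_norm_le_Lp_mul_Lq (μ := volume) Real.HolderConjugate.two_two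
    (hc.memLp_of_hasCompactSupport hs) (hd.memLp_of_hasCompactSupport hds)
  rw [integral_const_mul] at h2
  simp only [Real.rpow_two, Real.norm_eq_abs, sq_abs] at h2 h3
  set A := ∫ y, u y ^ 2 with hA
  set B := ∫ y, deriv u y ^ 2 with hB
  have hA0 : 0 ≤ A := integral_nonneg fun y => sq_nonneg _
  have hB0 : 0 ≤ B := integral_nonneg fun y => sq_nonneg _
  have key : ∀ a : ℝ, 0 ≤ a → a ^ ((1 : ℝ) / 2) = (a ^ ((1 : ℝ) / 4)) ^ 2 := by
    intro a ha
    rw [← Real.rpow_natCast, ← Real.rpow_mul ha]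
    norm_num
  have h4 : B ^ ((1 : ℝ) / 2) ≤ (A + B) ^ ((1 : ℝ) / 2) :=
    Real.rpow_le_rpow hB0 (by linarith) (by norm_num)
  have h5 := mul_le_mul_of_nonneg_left h4 (Real.rpow_nonneg hA0 ((1 : ℝ) / 2))
  rw [key A hA0, key (A + B) (by linarith)] at h5
  rw [key A hA0] at h3
  have hP := Real.rpow_nonneg hA0 ((1 : ℝ) / 4)
  have hQ := Real.rpow_nonneg (add_nonneg hA0 hB0) ((1 : ℝ) / 4)
  apply abs_le_of_sq_le_sq _ (by positivity)
  nlinarith [sq_nonneg (A ^ ((1 : ℝ) / 4) * (A + B) ^ ((1 : ℝ) / 4))]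
end

section
/- Ladyzhenskaya inequality in two dimensions: there is a constant C > 0 such that for every continuously differentiable function w : ℝ² → ℝ with compact support, ∫_{ℝ²} w(x)⁴ dx ≤ C ( ∫_{ℝ²} w(x)² dx ) ( ∫_{ℝ²} |∇w(x)|² dx ). -/
open MeasureTheory

set_option maxHeartbeats 2000000

/-- Ladyzhenskaya inequality in two dimensions:
`∫ w⁴ ≤ C (∫ w²) (∫ |∇w|²)` for `C¹` compactly supported `w : ℝ² → ℝ`. -/
theorem stmt16 :
    ∃ C : ℝ, 0 < C ∧
      ∀ w : ℝ × ℝ → ℝ, ContDiff ℝ 1 w → HasCompactSupport w →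
        (∫ x : ℝ × ℝ, (w x) ^ 4) ≤
          C * (∫ x : ℝ × ℝ, (w x) ^ 2) *
            (∫ x : ℝ × ℝ, ((fderiv ℝ w x (1, 0)) ^ 2 + (fderiv ℝ w x (0, 1)) ^ 2)) := by
  have hp : Real.HolderConjugate (Module.finrank ℝ (ℝ × ℝ)) 2 := by
    have : Module.finrank ℝ (ℝ × ℝ) = 2 := by simp
    rw [this]
    exact_mod_cast Real.HolderConjugate.two_two
  set K := lintegralPowLePowLIntegralFDerivConst (volume : Measure (ℝ × ℝ)) 2 with hK
  refine ⟨8 * (K : ℝ) + 1, by positivity, fun w hw hc => ?_⟩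
  have hcw : Continuous w := hw.continuous
  have hcd : Continuous (fderiv ℝ w) := hw.continuous_fderiv (by norm_num)
  have hcs : HasCompactSupport (fderiv ℝ w) := hc.fderiv ℝ
  have hu : ContDiff ℝ 1 (fun x => w x ^ 2) := hw.pow 2
  have hcu : HasCompactSupport (fun x => w x ^ 2) :=
    hc.comp_left (g := fun y : ℝ => y ^ 2) (by norm_num)
  have key := lintegral_pow_le_pow_lintegral_fderiv (volume : Measure (ℝ × ℝ)) hu hcu hp
  have hfd : ∀ x, ‖fderiv ℝ (fun x => w x ^ 2) x‖ = 2 * (|w x| * ‖fderiv ℝ w x‖) := by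
    intro x
    have h1 := ((hw.differentiable (by norm_num) x).hasFDerivAt.pow 2).fderiv
    rw [h1, norm_smul]
    simp [mul_assoc]
  have hg2 : HasCompactSupport (fun x => ‖fderiv ℝ w x‖ ^ 2) :=
    hcs.comp_left (g := fun y => ‖y‖ ^ 2) (by simp)
  have iw2 : Integrable (fun x => w x ^ 2) := hu.continuous.integrable_of_hasCompactSupport hcu
  have ig2 : Integrable (fun x => ‖fderiv ℝ w x‖ ^ 2) :=
    Continuous.integrable_of_hasCompactSupport (by fun_prop) hg2
  have iwg : Integrable (fun x => 2 * (|w x| * ‖fderiv ℝ w x‖)) := by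
    apply Continuous.integrable_of_hasCompactSupport (by fun_prop)
    exact (hcs.norm.mul_left (f := fun x => |w x|)).mul_left (f := fun _ => (2 : ℝ))
  have iw4 : Integrable (fun x => w x ^ 4) := by
    apply Continuous.integrable_of_hasCompactSupport (by fun_prop)
    exact hc.comp_left (g := fun y : ℝ => y ^ 4) (by norm_num)
  -- real form of the Gagliardo-Nirenberg-Sobolev inequality
  have key2 : (∫ x, w x ^ 4) ≤ K * (∫ x, 2 * (|w x| * ‖fderiv ℝ w x‖)) ^ 2 := by
    have e1 : (∫⁻ x, ‖w x ^ 2‖ₑ ^ (2 : ℝ)) = ENNReal.ofReal (∫ x, w x ^ 4) := by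
      rw [ofReal_integral_eq_lintegral_ofReal iw4 (Filter.Eventually.of_forall fun x => by positivity)]
      congr 1 with x
      rw [← ofReal_norm, ENNReal.ofReal_rpow_of_nonneg (norm_nonneg _) (by norm_num)]
      congr 1
      rw [Real.norm_of_nonneg (by positivity)]
      norm_cast
      ring
    have e2 : (∫⁻ x, ‖fderiv ℝ (fun x => w x ^ 2) x‖ₑ)
        = ENNReal.ofReal (∫ x, 2 * (|w x| * ‖fderiv ℝ w x‖)) := by
      rw [ofReal_integral_eq_lintegral_ofReal iwg (Filter.Eventually.of_forall fun x => by positivity)]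
      congr 1 with x
      rw [← ofReal_norm, hfd]
    have h0 : 0 ≤ ∫ x, 2 * (|w x| * ‖fderiv ℝ w x‖) := integral_nonneg fun x => by positivity
    rw [e1, e2, ENNReal.ofReal_rpow_of_nonneg h0 (by norm_num), ← hK,
      ← ENNReal.ofReal_coe_nnreal, ← ENNReal.ofReal_mul (by positivity)] at key
    have := (ENNReal.ofReal_le_ofReal_iff (by positivity)).1 key
    exact_mod_cast this
  -- Cauchy-Schwarz
  have cs : (∫ x, |w x| * ‖fderiv ℝ w x‖) ^ 2
      ≤ (∫ x, w x ^ 2) * (∫ x, ‖fderiv ℝ w x‖ ^ 2) := by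
    have := integral_mul_le_Lp_mul_Lq_of_nonneg (μ := (volume : Measure (ℝ × ℝ)))
      Real.HolderConjugate.two_two
      (f := fun x => |w x|) (g := fun x => ‖fderiv ℝ w x‖)
      (Filter.Eventually.of_forall fun x => abs_nonneg _)
      (Filter.Eventually.of_forall fun x => norm_nonneg _)
      (hcw.abs.memLp_of_hasCompactSupport hc.norm)
      (hcd.norm.memLp_of_hasCompactSupport hcs.norm)
    simp only [Real.rpow_two, sq_abs, ← Real.sqrt_eq_rpow] at this
    have h0 : 0 ≤ ∫ x, |w x| * ‖fderiv ℝ w x‖ := integral_nonneg fun x => by positivity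
    calc _ ≤ _ := pow_le_pow_left₀ h0 this 2
      _ = _ := by
        rw [mul_pow, Real.sq_sqrt (integral_nonneg fun x => by positivity),
          Real.sq_sqrt (integral_nonneg fun x => by positivity)]
  have hG : (∫ x, ‖fderiv ℝ w x‖ ^ 2)
      ≤ 2 * ∫ x, ((fderiv ℝ w x (1, 0)) ^ 2 + (fderiv ℝ w x (0, 1)) ^ 2) := by
    rw [← integral_const_mul]
    apply integral_mono ig2
    · apply Continuous.integrable_of_hasCompactSupport (by fun_prop)
      exact hcs.comp_left
        (g := fun L : ℝ × ℝ →L[ℝ] ℝ => 2 * ((L (1, 0)) ^ 2 + (L (0, 1)) ^ 2)) (by simp)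
    · intro x
      set L := fderiv ℝ w x
      have hL : ‖L‖ ≤ |L (1, 0)| + |L (0, 1)| := by
        refine L.opNorm_le_bound (by positivity) fun v => ?_
        have hv : L v = v.1 * L (1, 0) + v.2 * L (0, 1) := by
          rw [← smul_eq_mul, ← smul_eq_mul, ← map_smul, ← map_smul, ← map_add]
          simp
        rw [hv, Real.norm_eq_abs]
        have h1 : |v.1| ≤ ‖v‖ := norm_fst_le v
        have h2 : |v.2| ≤ ‖v‖ := norm_snd_le v
        calc _ ≤ _ := abs_add_le _ _
          _ = |v.1| * |L (1, 0)| + |v.2| * |L (0, 1)| := by rw [abs_mul, abs_mul]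
          _ ≤ ‖v‖ * |L (1, 0)| + ‖v‖ * |L (0, 1)| := by gcongr
          _ = _ := by ring
      have := pow_le_pow_left₀ (norm_nonneg _) hL 2
      change ‖L‖ ^ 2 ≤ 2 * ((L (1, 0)) ^ 2 + (L (0, 1)) ^ 2)
      nlinarith [sq_nonneg (|L (1, 0)| - |L (0, 1)|), sq_abs (L (1, 0)), sq_abs (L (0, 1))]
  rw [integral_const_mul] at key2
  have hA : 0 ≤ ∫ x, w x ^ 2 := integral_nonneg fun x => by positivity
  have hB : 0 ≤ ∫ x, ((fderiv ℝ w x (1, 0)) ^ 2 + (fderiv ℝ w x (0, 1)) ^ 2) :=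
    integral_nonneg fun x => by positivity
  have hcs2 := cs.trans (mul_le_mul_of_nonneg_left hG hA)
  have hK0 : (0 : ℝ) ≤ K := K.2
  have := mul_le_mul_of_nonneg_left hcs2 hK0
  have := mul_nonneg hA hB
  nlinarith
end

section
/- Anisotropic L³ interpolation inequality: there is a constant C > 0 such that for every continuously differentiable function u : ℝ² → ℝ with compact support, ∫_{ℝ²} |u(x)|³ dx ≤ C ( ‖∂₁ u‖_{L²(ℝ²)} + ‖u‖_{L²(ℝ²)} )^{1/2} ( ‖∂₂ u‖_{L²(ℝ²)} + ‖u‖_{L²(ℝ²)} )^{1/2} ‖u‖_{L²(ℝ²)}². -/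
open MeasureTheory

lemma aux_one_dim (f : ℝ → ℝ) (hf : ContDiff ℝ 1 f) (hc : HasCompactSupport f) (x : ℝ) :
    f x ^ 2 ≤ ∫ t, |2 * (f t * deriv f t)| := by
  have hd : ∀ t, HasDerivAt f (deriv f t) t := fun t =>
    (hf.differentiable one_ne_zero t).hasDerivAt
  have hder : deriv (fun t => f t ^ 2) = fun t => 2 * (f t * deriv f t) := by
    funext t
    have := ((hd t).pow 2).deriv
    simp only [Pi.pow_def] at this
    rw [this]; norm_num; ring
  have hcs : HasCompactSupport (fun t => f t ^ 2) :=
    hc.comp_left (g := fun y : ℝ => y ^ 2) (by simp)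
  have h := hcs.integral_Iic_deriv_eq (hf.pow 2) x
  rw [hder] at h
  have hcont : Continuous (deriv f) := hf.continuous_deriv le_rfl
  have hint : Integrable (fun t => |2 * (f t * deriv f t)|) := by
    apply Integrable.abs
    apply Integrable.const_mul
    exact (hf.continuous.mul hcont).integrable_of_hasCompactSupport hc.mul_right
  rw [← h]
  calc _ ≤ ∫ t in Set.Iic x, |2 * (f t * deriv f t)| :=
        (le_abs_self _).trans (abs_integral_le_integral_abs)
    _ ≤ _ := setIntegral_le_integral hint (Filter.Eventually.of_forall fun t => abs_nonneg _)

lemma aux_cs (g h : ℝ × ℝ → ℝ) (hg : Continuous g) (hh : Continuous h)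
    (cg : HasCompactSupport g) (ch : HasCompactSupport h) :
    ∫ x, |g x * h x| ≤ (∫ x, g x ^ 2) ^ ((1 : ℝ) / 2) * (∫ x, h x ^ 2) ^ ((1 : ℝ) / 2) := by
  have := integral_mul_le_Lp_mul_Lq_of_nonneg (μ := (volume : Measure (ℝ × ℝ)))
    (p := 2) (q := 2) (f := fun x => |g x|) (g := fun x => |h x|)
    Real.HolderConjugate.two_two
    (Filter.Eventually.of_forall fun t => abs_nonneg _)
    (Filter.Eventually.of_forall fun t => abs_nonneg _)
    (hg.abs.memLp_of_hasCompactSupport (cg.comp_left (g := fun y : ℝ => |y|) (by simp)))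
    (hh.abs.memLp_of_hasCompactSupport (ch.comp_left (g := fun y : ℝ => |y|) (by simp)))
  simpa [abs_mul] using this

lemma aux_lady (u : ℝ × ℝ → ℝ) (hu : ContDiff ℝ 1 u) (hc : HasCompactSupport u) :
    ∫ x, (u x ^ 2) ^ 2 ≤ (∫ x, |2 * (u x * fderiv ℝ u x (1, 0))|) *
      (∫ x, |2 * (u x * fderiv ℝ u x (0, 1))|) := by
  have hfd : Continuous (fderiv ℝ u) := hu.continuous_fderiv one_ne_zero
  have hi : ∀ v : ℝ × ℝ, Integrable (fun x => |2 * (u x * fderiv ℝ u x v)|) := fun v =>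
    (((hu.continuous.mul (hfd.clm_apply continuous_const)).integrable_of_hasCompactSupport
      hc.mul_right).const_mul 2).abs
  have hdu : Differentiable ℝ u := hu.differentiable one_ne_zero
  have h1 : ∀ x y : ℝ, u (x, y) ^ 2 ≤
      ∫ s, |2 * (u (s, y) * fderiv ℝ u (s, y) (1, 0))| := by
    intro x y
    have hemb : Topology.IsClosedEmbedding (fun s : ℝ => (s, y)) :=
      (isometry_iff_dist_eq.2 (fun a b => by simp [Prod.dist_eq])).isClosedEmbedding
    have h := aux_one_dim (fun s => u (s, y)) (hu.comp (by fun_prop))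
      (hc.comp_isClosedEmbedding hemb) x
    have hder : ∀ s, deriv (fun s => u (s, y)) s = fderiv ℝ u (s, y) (1, 0) := fun s =>
      ((hdu (s, y)).hasFDerivAt.comp_hasDerivAt s
        ((hasDerivAt_id s).prodMk (hasDerivAt_const s y))).deriv
    simpa only [hder] using h
  have h2 : ∀ x y : ℝ, u (x, y) ^ 2 ≤
      ∫ s, |2 * (u (x, s) * fderiv ℝ u (x, s) (0, 1))| := by
    intro x y
    have hemb : Topology.IsClosedEmbedding (fun s : ℝ => (x, s)) :=
      (isometry_iff_dist_eq.2 (fun a b => by simp [Prod.dist_eq])).isClosedEmbedding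
    have h := aux_one_dim (fun s => u (x, s)) (hu.comp (by fun_prop))
      (hc.comp_isClosedEmbedding hemb) y
    have hder : ∀ s, deriv (fun s => u (x, s)) s = fderiv ℝ u (x, s) (0, 1) := fun s =>
      ((hdu (x, s)).hasFDerivAt.comp_hasDerivAt s
        ((hasDerivAt_const s x).prodMk (hasDerivAt_id s))).deriv
    simpa only [hder] using h
  have i1 := hi (1, 0)
  have i2 := hi (0, 1)
  rw [Measure.volume_eq_prod] at i1 i2 ⊢
  rw [integral_prod_symm _ i1, integral_prod _ i2, mul_comm, ← integral_prod_mul]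
  apply integral_mono_of_nonneg (Filter.Eventually.of_forall fun t => by positivity)
  · exact i2.integral_prod_left.mul_prod i1.integral_prod_right
  · refine Filter.Eventually.of_forall fun t => ?_
    obtain ⟨x, y⟩ := t
    have := mul_le_mul (h2 x y) (h1 x y) (sq_nonneg _) ((sq_nonneg _).trans (h2 x y))
    simpa only [sq (u (x, y) ^ 2)] using this

/-- anisotropic `L³` interpolation inequality:
`∫ |u|³ ≤ C (‖∂₁u‖_{L²} + ‖u‖_{L²})^{1/2} (‖∂₂u‖_{L²} + ‖u‖_{L²})^{1/2} ‖u‖²_{L²}`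
for `C¹` compactly supported `u : ℝ² → ℝ`. -/
theorem stmt18 :
    ∃ C : ℝ, 0 < C ∧
      ∀ u : ℝ × ℝ → ℝ, ContDiff ℝ 1 u → HasCompactSupport u →
        (∫ x : ℝ × ℝ, |u x| ^ 3) ≤
          C * ((∫ x : ℝ × ℝ, (fderiv ℝ u x (1, 0)) ^ 2) ^ ((1 : ℝ) / 2) +
                (∫ x : ℝ × ℝ, (u x) ^ 2) ^ ((1 : ℝ) / 2)) ^ ((1 : ℝ) / 2) *
            ((∫ x : ℝ × ℝ, (fderiv ℝ u x (0, 1)) ^ 2) ^ ((1 : ℝ) / 2) +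
                (∫ x : ℝ × ℝ, (u x) ^ 2) ^ ((1 : ℝ) / 2)) ^ ((1 : ℝ) / 2) *
            ((∫ x : ℝ × ℝ, (u x) ^ 2) ^ ((1 : ℝ) / 2)) ^ 2 := by
  refine ⟨2, two_pos, fun u hu hc => ?_⟩
  have hfd : Continuous (fderiv ℝ u) := hu.continuous_fderiv one_ne_zero
  have hD : ∀ v : ℝ × ℝ, ∫ x, |2 * (u x * fderiv ℝ u x v)| ≤
      2 * ((∫ x, u x ^ 2) ^ ((1 : ℝ) / 2) * (∫ x, (fderiv ℝ u x v) ^ 2) ^ ((1 : ℝ) / 2)) := by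
    intro v
    have := aux_cs u (fun x => fderiv ℝ u x v) hu.continuous (hfd.clm_apply continuous_const) hc
      (hc.fderiv_apply ℝ v)
    simp only [abs_mul (2 : ℝ), abs_two, integral_const_mul]
    linarith
  have h0 := aux_cs u (fun x => u x ^ 2) hu.continuous (hu.continuous.pow 2) hc
    (hc.comp_left (g := fun y : ℝ => y ^ 2) (by simp))
  have e : ∀ x, |u x * u x ^ 2| = |u x| ^ 3 := fun x => by
    rw [← abs_pow]; congr 1; ring
  simp only [e] at h0
  have hl := aux_lady u hu hc
  have d1 := hD (1, 0)
  have d2 := hD (0, 1)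
  have n4 : 0 ≤ ∫ x, (u x ^ 2) ^ 2 := integral_nonneg fun x => by positivity
  have n2 : 0 ≤ ∫ x, |2 * (u x * fderiv ℝ u x (0, 1))| := integral_nonneg fun x => by positivity
  have nm : 0 ≤ (∫ x, u x ^ 2) ^ ((1 : ℝ) / 2) :=
    Real.rpow_nonneg (integral_nonneg fun x => by positivity) _
  have na : 0 ≤ (∫ x, (fderiv ℝ u x (1, 0)) ^ 2) ^ ((1 : ℝ) / 2) :=
    Real.rpow_nonneg (integral_nonneg fun x => by positivity) _
  have nb : 0 ≤ (∫ x, (fderiv ℝ u x (0, 1)) ^ 2) ^ ((1 : ℝ) / 2) :=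
    Real.rpow_nonneg (integral_nonneg fun x => by positivity) _
  generalize (∫ x, u x ^ 2) ^ ((1 : ℝ) / 2) = m at *
  generalize (∫ x, (fderiv ℝ u x (1, 0)) ^ 2) ^ ((1 : ℝ) / 2) = a at *
  generalize (∫ x, (fderiv ℝ u x (0, 1)) ^ 2) ^ ((1 : ℝ) / 2) = b at *
  have hl2 : ∫ x, (u x ^ 2) ^ 2 ≤ (2 * m) ^ 2 * ((a + m) * (b + m)) := by
    calc _ ≤ (2 * (m * a)) * (2 * (m * b)) := hl.trans (mul_le_mul d1 d2 n2 (by positivity))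
      _ = (2 * m) ^ 2 * (a * b) := by ring
      _ ≤ _ := by gcongr <;> linarith
  simp only [← Real.sqrt_eq_rpow] at *
  refine h0.trans ?_
  have h3 := Real.sqrt_le_sqrt hl2
  rw [Real.sqrt_mul (by positivity), Real.sqrt_sq (by positivity),
    Real.sqrt_mul (by positivity)] at h3
  calc _ ≤ m * (2 * m * (√(a + m) * √(b + m))) := by gcongr
    _ = _ := by ring
end

section
/- Commutator of normal and tangential derivatives: let U ⊆ ℝ² be open, let d : U → ℝ be smooth with |∇d(x)| = 1 for all x ∈ U, and set n = ∇d (so n is a smooth unit vector field). Then (a) (n·∇)n = 0 on U; and (b) for every smooth g : U → ℝ and every x ∈ U, (n·∇)[(I - n⊗n)∇g](x) - (I - n(x)⊗n(x)) ∇( n·∇g )(x) = - Σ_{j=1}^{2} [ (I - n(x)⊗n(x)) ∇n_j(x) ] ∂_{x_j} g(x), i.e. the commutator [∂_n, ∇_τ] g is a first-order tangential differential operator applied to g. -/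
/-- Partial derivative in the first coordinate direction on `ℝ²`. -/
noncomputable def d1 (u : ℝ × ℝ → ℝ) : ℝ × ℝ → ℝ := fun x => fderiv ℝ u x (1, 0)

/-- Partial derivative in the second coordinate direction on `ℝ²`. -/
noncomputable def d2 (u : ℝ × ℝ → ℝ) : ℝ × ℝ → ℝ := fun x => fderiv ℝ u x (0, 1)

/-- Normal derivative `∂_n g = n·∇g` along the vector field `n = ∇d`. -/
noncomputable def normalDer (d g : ℝ × ℝ → ℝ) : ℝ × ℝ → ℝ :=
  fun y => d1 d y * d1 g y + d2 d y * d2 g y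

/-- First component of the tangential gradient `∇_τ g = (I - n⊗n)∇g`, `n = ∇d`. -/
noncomputable def tang1 (d g : ℝ × ℝ → ℝ) : ℝ × ℝ → ℝ :=
  fun y => d1 g y - d1 d y * normalDer d g y

/-- Second component of the tangential gradient `∇_τ g = (I - n⊗n)∇g`, `n = ∇d`. -/
noncomputable def tang2 (d g : ℝ × ℝ → ℝ) : ℝ × ℝ → ℝ :=
  fun y => d2 g y - d2 d y * normalDer d g y

lemma d1_mul_add {a b : ℝ × ℝ → ℝ} {x : ℝ × ℝ} (ha : DifferentiableAt ℝ a x)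
    (hb : DifferentiableAt ℝ b x) :
    d1 (fun y => a y * b y) x = d1 a x * b x + a x * d1 b x := by
  unfold d1
  rw [fderiv_fun_mul ha hb]
  simp
  ring

lemma d2_mul_add {a b : ℝ × ℝ → ℝ} {x : ℝ × ℝ} (ha : DifferentiableAt ℝ a x)
    (hb : DifferentiableAt ℝ b x) :
    d2 (fun y => a y * b y) x = d2 a x * b x + a x * d2 b x := by
  unfold d2
  rw [fderiv_fun_mul ha hb]
  simp
  ring

lemma contDiffOn_d1 {U : Set (ℝ × ℝ)} (hU : IsOpen U) {u : ℝ × ℝ → ℝ}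
    (hu : ContDiffOn ℝ (⊤ : ℕ∞) u U) : ContDiffOn ℝ (⊤ : ℕ∞) (d1 u) U :=
  (hu.fderiv_of_isOpen hU (by simp)).clm_apply contDiffOn_const

lemma contDiffOn_d2 {U : Set (ℝ × ℝ)} (hU : IsOpen U) {u : ℝ × ℝ → ℝ}
    (hu : ContDiffOn ℝ (⊤ : ℕ∞) u U) : ContDiffOn ℝ (⊤ : ℕ∞) (d2 u) U :=
  (hu.fderiv_of_isOpen hU (by simp)).clm_apply contDiffOn_const

lemma diffAt_of_smooth {U : Set (ℝ × ℝ)} (hU : IsOpen U) {u : ℝ × ℝ → ℝ}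
    (hu : ContDiffOn ℝ (⊤ : ℕ∞) u U) {x : ℝ × ℝ} (hx : x ∈ U) : DifferentiableAt ℝ u x :=
  (hu.contDiffAt (hU.mem_nhds hx)).differentiableAt (by simp)

lemma d1_d2_comm {U : Set (ℝ × ℝ)} (hU : IsOpen U) {u : ℝ × ℝ → ℝ}
    (hu : ContDiffOn ℝ (⊤ : ℕ∞) u U) {x : ℝ × ℝ} (hx : x ∈ U) :
    d1 (d2 u) x = d2 (d1 u) x := by
  have hs : IsSymmSndFDerivAt ℝ u x :=
    (hu.contDiffAt (hU.mem_nhds hx)).isSymmSndFDerivAt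
      (by simp only [minSmoothness_of_isRCLikeNormedField]; exact WithTop.coe_le_coe.2 (le_top : (2 : ℕ∞) ≤ ⊤))
  have hf : DifferentiableAt ℝ (fderiv ℝ u) x :=
    ((hu.fderiv_of_isOpen (m := (⊤ : ℕ∞)) hU (by simp)).contDiffAt
      (hU.mem_nhds hx)).differentiableAt (by simp)
  have key : ∀ v w : ℝ × ℝ, fderiv ℝ (fun y => fderiv ℝ u y v) x w
      = fderiv ℝ (fderiv ℝ u) x w v := by
    intro v w
    rw [fderiv_clm_apply hf (differentiableAt_const v)]
    simp
  change fderiv ℝ (fun y => fderiv ℝ u y (0, 1)) x (1, 0)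
    = fderiv ℝ (fun y => fderiv ℝ u y (1, 0)) x (0, 1)
  rw [key, key]
  exact hs _ _

/-- commutator of normal and tangential derivatives.  If `d` is a
smooth signed distance function (`|∇d| = 1`) on an open set `U ⊆ ℝ²` and
`n = ∇d`, then (a) `(n·∇)n = 0` on `U`, and (b) for every smooth `g` on `U`,
`[∂_n, ∇_τ] g = - Σ_j ((I - n⊗n)∇n_j) ∂_{x_j} g` on `U` (componentwise). -/
theorem stmt19 (U : Set (ℝ × ℝ)) (hU : IsOpen U) (d : ℝ × ℝ → ℝ)
    (hd : ContDiffOn ℝ (⊤ : ℕ∞) d U)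
    (heik : ∀ x ∈ U, (d1 d x) ^ 2 + (d2 d x) ^ 2 = 1) :
    -- (a) `(n·∇)n = 0` on `U`, componentwise
    (∀ x ∈ U, normalDer d (d1 d) x = 0 ∧ normalDer d (d2 d) x = 0) ∧
    -- (b) the commutator identity, componentwise
    (∀ g : ℝ × ℝ → ℝ, ContDiffOn ℝ (⊤ : ℕ∞) g U → ∀ x ∈ U,
      (normalDer d (tang1 d g) x - tang1 d (normalDer d g) x =
        -(tang1 d (d1 d) x * d1 g x + tang1 d (d2 d) x * d2 g x)) ∧
      (normalDer d (tang2 d g) x - tang2 d (normalDer d g) x =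
        -(tang2 d (d1 d) x * d1 g x + tang2 d (d2 d) x * d2 g x))) := by
  have hn1 := contDiffOn_d1 hU hd
  have hn2 := contDiffOn_d2 hU hd
  have dn : ∀ f : ℝ × ℝ → ℝ, ContDiffOn ℝ (⊤ : ℕ∞) f U →
      ContDiffOn ℝ (⊤ : ℕ∞) (normalDer d f) U := fun f hf =>
    (hn1.mul (contDiffOn_d1 hU hf)).add (hn2.mul (contDiffOn_d2 hU hf))
  -- derivatives of a normal derivative
  have dN : ∀ f : ℝ × ℝ → ℝ, ContDiffOn ℝ (⊤ : ℕ∞) f U → ∀ x ∈ U,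
      d1 (normalDer d f) x = d1 (d1 d) x * d1 f x + d1 d x * d1 (d1 f) x
        + (d1 (d2 d) x * d2 f x + d2 d x * d1 (d2 f) x) ∧
      d2 (normalDer d f) x = d2 (d1 d) x * d1 f x + d1 d x * d2 (d1 f) x
        + (d2 (d2 d) x * d2 f x + d2 d x * d2 (d2 f) x) := by
    intro f hf x hx
    have e1 := diffAt_of_smooth hU hn1 hx
    have e2 := diffAt_of_smooth hU hn2 hx
    have f1 := diffAt_of_smooth hU (contDiffOn_d1 hU hf) hx
    have f2 := diffAt_of_smooth hU (contDiffOn_d2 hU hf) hx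
    rw [← d1_mul_add e1 f1, ← d1_mul_add e2 f2, ← d2_mul_add e1 f1, ← d2_mul_add e2 f2]
    constructor
    · unfold normalDer
      rw [d1, fderiv_fun_add (e1.fun_mul f1) (e2.fun_mul f2)]
      rfl
    · unfold normalDer
      rw [d2, fderiv_fun_add (e1.fun_mul f1) (e2.fun_mul f2)]
      rfl
  have A : ∀ x ∈ U, normalDer d (d1 d) x = 0 ∧ normalDer d (d2 d) x = 0 := by
    intro x hx
    have hc : normalDer d d =ᶠ[nhds x] fun _ => (1 : ℝ) := by
      filter_upwards [hU.mem_nhds hx] with y hy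
      have := heik y hy
      simp only [normalDer]
      linarith
    have h1 : d1 (normalDer d d) x = 0 := by
      rw [d1, hc.fderiv_eq]; simp
    have h2 : d2 (normalDer d d) x = 0 := by
      rw [d2, hc.fderiv_eq]; simp
    obtain ⟨k1, k2⟩ := dN d hd x hx
    have hs := d1_d2_comm hU hd hx
    simp only [normalDer]
    constructor
    · rw [← hs]; linarith
    · rw [hs]; linarith
  refine ⟨A, fun g hg x hx => ?_⟩
  have hN := dn g hg
  have N := diffAt_of_smooth hU hN hx
  have e1 := diffAt_of_smooth hU hn1 hx
  have e2 := diffAt_of_smooth hU hn2 hx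
  have g1 := diffAt_of_smooth hU (contDiffOn_d1 hU hg) hx
  have g2 := diffAt_of_smooth hU (contDiffOn_d2 hU hg) hx
  obtain ⟨a1, a2⟩ := A x hx
  obtain ⟨k1, k2⟩ := dN g hg x hx
  have hsg := d1_d2_comm hU hg hx
  have hsd := d1_d2_comm hU hd hx
  have t11 : d1 (tang1 d g) x = d1 (d1 g) x
      - (d1 (d1 d) x * normalDer d g x + d1 d x * d1 (normalDer d g) x) := by
    rw [← d1_mul_add e1 N]; unfold tang1
    rw [d1, fderiv_fun_sub g1 (e1.fun_mul N)]; rfl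
  have t12 : d2 (tang1 d g) x = d2 (d1 g) x
      - (d2 (d1 d) x * normalDer d g x + d1 d x * d2 (normalDer d g) x) := by
    rw [← d2_mul_add e1 N]; unfold tang1
    rw [d2, fderiv_fun_sub g1 (e1.fun_mul N)]; rfl
  have t21 : d1 (tang2 d g) x = d1 (d2 g) x
      - (d1 (d2 d) x * normalDer d g x + d2 d x * d1 (normalDer d g) x) := by
    rw [← d1_mul_add e2 N]; unfold tang2
    rw [d1, fderiv_fun_sub g2 (e2.fun_mul N)]; rfl
  have t22 : d2 (tang2 d g) x = d2 (d2 g) x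
      - (d2 (d2 d) x * normalDer d g x + d2 d x * d2 (normalDer d g) x) := by
    rw [← d2_mul_add e2 N]; unfold tang2
    rw [d2, fderiv_fun_sub g2 (e2.fun_mul N)]; rfl
  constructor
  · have l1 : normalDer d (tang1 d g) x
        = d1 d x * d1 (tang1 d g) x + d2 d x * d2 (tang1 d g) x := rfl
    have l2 : tang1 d (normalDer d g) x = d1 (normalDer d g) x - d1 d x *
        (d1 d x * d1 (normalDer d g) x + d2 d x * d2 (normalDer d g) x) := rfl
    have l3 : tang1 d (d1 d) x = d1 (d1 d) x := by simp [tang1, a1]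
    have l4 : tang1 d (d2 d) x = d1 (d2 d) x := by simp [tang1, a2]
    have a1' : d1 d x * d1 (d1 d) x + d2 d x * d2 (d1 d) x = 0 := a1
    rw [l1, l2, l3, l4, t11, t12]
    linear_combination (-normalDer d g x) * a1' - k1 - d2 d x * hsg
  · have l1 : normalDer d (tang2 d g) x
        = d1 d x * d1 (tang2 d g) x + d2 d x * d2 (tang2 d g) x := rfl
    have l2 : tang2 d (normalDer d g) x = d2 (normalDer d g) x - d2 d x *
        (d1 d x * d1 (normalDer d g) x + d2 d x * d2 (normalDer d g) x) := rfl
    have l3 : tang2 d (d1 d) x = d2 (d1 d) x := by simp [tang2, a1]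
    have l4 : tang2 d (d2 d) x = d2 (d2 d) x := by simp [tang2, a2]
    have a2' : d1 d x * d1 (d2 d) x + d2 d x * d2 (d2 d) x = 0 := a2
    rw [l1, l2, l3, l4, t21, t22]
    linear_combination (-normalDer d g x) * a2' - k2 + d1 d x * hsg
end
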